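/- Let σ² > 0, C_4 > 0, M_1 > 0, ξ_1 ≥ 2, and δ_1 > 0 with β > 1 + δ_1, and let c : ℕ → ℝ be a nonincreasing nonnegative sequence satisfying (C_4 − M_1 k^{−ξ_1}) k^{−β} ≤ c_k ≤ (C_4 + M_1 k^{−ξ_1}) k^{−β} for all k ≥ 1. Let K_n satisfy C_l ≤ K_n^{2+δ_1}/n ≤ C_u for some positive C_l, C_u, set N = n − K_n, L_n(k) = (k/N)σ² + c_k for 1 ≤ k ≤ K_n, and let k_n* minimize L_n over {1,…,K_n}. Then there exist C_6 > 0 and C_7 > 0 such that for all sufficiently large n and all k ∈ {1,…,K_n} with |k − k_n*| > C_6, N(L_n(k) − L_n(k_n*)) / |k − k_n*| ≥ C_7 · min(|k − k_n*|/k_n*, 1). Consequently, for any ξ > 0, condition (K.6) is satisfied with any θ ∈ (1 − min{ξ,1}, 1). -/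

import Mathlib

open Filter

/-- Lower convexity bound. -/
lemma aux_low (β t : ℝ) (hβ : 1 < β) (ht : 0 < t) :
    1 - β * (t - 1) + β * ((t - 1) ^ 2 / t) ≤ t ^ (-β) := by
  have h := one_add_mul_self_le_rpow_one_add (s := t⁻¹ - 1)
    (by have := inv_pos.mpr ht; linarith) hβ.le
  have e : 1 + (t⁻¹ - 1) = t⁻¹ := by ring
  rw [e, Real.inv_rpow ht.le, ← Real.rpow_neg ht.le] at h
  have e2 : 1 - β * (t - 1) + β * ((t - 1) ^ 2 / t) = 1 + β * (t⁻¹ - 1) := by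
    field_simp; ring
  linarith

/-- Upper second-order bound. -/
lemma aux_up (β t : ℝ) (hβ : 1 < β) (ht : 0 < t) (h1 : -(1/2) ≤ β * (t - 1)) :
    t ^ (-β) ≤ 1 - β * (t - 1) + 2 * (β * (t - 1)) ^ 2 := by
  have h := one_add_mul_self_le_rpow_one_add (s := t - 1) (by linarith) hβ.le
  have e : 1 + (t - 1) = t := by ring
  rw [e] at h
  rw [Real.rpow_neg ht.le]
  set v := β * (t - 1)
  have hpos : 0 < 1 + v := by linarith
  calc (t ^ β)⁻¹ ≤ (1 + v)⁻¹ := inv_anti₀ hpos h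
    _ ≤ _ := by
      rw [inv_le_iff_one_le_mul₀ hpos]
      nlinarith [mul_nonneg (sq_nonneg v) (by linarith : 0 ≤ 1 + 2 * v)]

lemma aux_near (s β E : ℝ) (hβ : 1 < β) (hE : 0 < E)
    (m k : ℕ) (lam : ℝ) (G : ℕ → ℝ) (hlam : 0 < lam)
    (hm : 2 * β ≤ m) (hk : 1 ≤ k) (hkm : |(k : ℝ) - m| = 1)
    (hF : ∀ k : ℕ, 1 ≤ k → |G k - lam * m / β * ((k : ℝ) / m) ^ (-β)|
      ≤ lam * E / m * ((k : ℝ) / m) ^ (-β - 2))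
    (hO : G m + s * m ≤ G k + s * k) :
    (lam - s) * ((k : ℝ) - m) ≤
      lam * (2 * β + E * ((1 / 2 : ℝ) ^ (-β - 2) + 1)) / m := by
  have hm0 : (0 : ℝ) < m := by linarith
  have hk0 : (0 : ℝ) < k := by exact_mod_cast hk
  have hm1 : 1 ≤ m := by exact_mod_cast hm0
  have h1 := hF k hk
  have h2 := hF m hm1
  rw [div_self hm0.ne', Real.one_rpow, Real.one_rpow] at h2
  have hj := abs_le.mp hkm.le
  have hsq : ((k : ℝ) - m) ^ 2 = 1 := by rw [← sq_abs, hkm]; norm_num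
  have ht : (0 : ℝ) < (k : ℝ) / m := by positivity
  have ht1 : (k : ℝ) / m - 1 = ((k : ℝ) - m) / m := by field_simp
  have hv : -(1/2) ≤ β * ((k : ℝ) / m - 1) := by
    rw [ht1, ← mul_div_assoc, le_div_iff₀ hm0]; nlinarith
  have h3 := aux_up β _ hβ ht hv
  have h4 : ((k : ℝ) / m) ^ (-β - 2) ≤ (1 / 2 : ℝ) ^ (-β - 2) := by
    apply Real.rpow_le_rpow_of_nonpos (by norm_num) _ (by linarith)
    rw [div_le_div_iff₀ (by norm_num) hm0]; linarith
  have h1' := (abs_le.mp h1).2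
  have h2' := (abs_le.mp h2).1
  have h5 : lam * m / β * ((k : ℝ) / m) ^ (-β) ≤
      lam * m / β * (1 - β * ((k : ℝ) / m - 1) + 2 * (β * ((k : ℝ) / m - 1)) ^ 2) :=
    mul_le_mul_of_nonneg_left h3 (by positivity)
  have h6 : lam * E / m * ((k : ℝ) / m) ^ (-β - 2) ≤ lam * E / m * (1 / 2 : ℝ) ^ (-β - 2) :=
    mul_le_mul_of_nonneg_left h4 (by positivity)
  have e1 : lam * m / β * (1 - β * ((k : ℝ) / m - 1) + 2 * (β * ((k : ℝ) / m - 1)) ^ 2)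
      = lam * m / β - lam * ((k : ℝ) - m) + 2 * β * lam / m := by
    have : (β * ((k : ℝ) / m - 1)) ^ 2 = β ^ 2 / m ^ 2 := by
      rw [ht1, mul_pow, div_pow, hsq]; ring
    rw [this, ht1]; field_simp
  have e2 : lam * (2 * β + E * ((1 / 2 : ℝ) ^ (-β - 2) + 1)) / m
     = 2 * β * lam / m + lam * E / m * (1 / 2 : ℝ) ^ (-β - 2) + lam * E / m := by ring
  rw [e2]
  linarith

set_option maxHeartbeats 2000000 in
lemma aux_core (s β E : ℝ) (hs : 0 < s) (hβ : 1 < β) (hE : 0 < E) :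
    ∃ m0 C6 C7 : ℝ, 0 < C6 ∧ 0 < C7 ∧ ∀ (m K : ℕ) (lam : ℝ) (G : ℕ → ℝ), m0 ≤ m → m + 1 ≤ K →
      0 < lam → Antitone G →
      (∀ k : ℕ, 1 ≤ k → |G k - lam * m / β * ((k : ℝ) / m) ^ (-β)|
        ≤ lam * E / m * ((k : ℝ) / m) ^ (-β - 2)) →
      (∀ k : ℕ, 1 ≤ k → k ≤ K → G m + s * m ≤ G k + s * k) →
      ∀ k : ℕ, 1 ≤ k → k ≤ K → C6 < |(k : ℝ) - m| →
        C7 * min (|(k : ℝ) - m| / m) 1 * |(k : ℝ) - m| ≤ G k + s * k - (G m + s * m) := by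
  set B : ℝ := 2 * β + E * ((1 / 2 : ℝ) ^ (-β - 2) + 1) with hB
  have hBpos : 0 < B := by positivity
  set τ : ℝ := 1 / (4 * β * (3 + 1 / β + E)) with hτ
  have hβ0 : 0 < β := by linarith
  have hτ0 : 0 < τ := by positivity
  have hτ12 : τ ≤ 1 / 12 := by
    rw [hτ]; apply one_div_le_one_div_of_le (by norm_num)
    have : 0 < 1 / β := by positivity
    nlinarith
  set B2 : ℝ := B + E * (τ ^ (-β - 2) + 1) with hB2
  have hB2pos : 0 < B2 := by positivity
  refine ⟨2 * β + 2 * B + 4 * B2 + 1 / τ + 2 * E * β / τ ^ 2 + 2, 4 * B2 + 1, s / 8,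
    by positivity, by positivity, ?_⟩
  intro m K lam G hm hmK hlam hG hF hO k hk hkK hd
  have p1 : 0 < 1 / τ := by positivity
  have p2 : 0 < 2 * E * β / τ ^ 2 := by positivity
  have hm2 : (2 : ℝ) ≤ m := by linarith
  have hm0 : (0 : ℝ) < m := by linarith
  have hm2' : 2 ≤ m := by exact_mod_cast hm2
  have n1 := aux_near s β E hβ hE m (m + 1) lam G hlam (by linarith) (by omega)
    (by push_cast; norm_num) hF (hO _ (by omega) hmK)
  have n2 := aux_near s β E hβ hE m (m - 1) lam G hlam (by linarith) (by omega)
    (by rw [Nat.cast_sub (by omega)]; push_cast; norm_num) hF (hO _ (by omega) (by omega))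
  rw [Nat.cast_sub (by omega)] at n2
  push_cast at n1 n2
  rw [← hB] at n1 n2
  have n1' : lam - s ≤ lam * B / m := by linarith
  have n2' : s - lam ≤ lam * B / m := by linarith
  have hBm : lam * B / m ≤ lam / 2 := by
    rw [div_le_div_iff₀ hm0 (by norm_num)]; nlinarith
  have hls : s / 2 ≤ lam := by linarith
  have hk0 : (0 : ℝ) < k := by exact_mod_cast hk
  set d := |(k : ℝ) - m| with hdd
  have hd0 : 0 < d := by linarith
  have h2 := hF m (by omega)
  rw [div_self hm0.ne', Real.one_rpow, Real.one_rpow] at h2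
  by_cases hkt : τ * m ≤ k
  · have h1 := hF k hk
    have ht : (0 : ℝ) < (k : ℝ) / m := by positivity
    have ht1 : (k : ℝ) / m - 1 = ((k : ℝ) - m) / m := by field_simp
    have h4 : ((k : ℝ) / m) ^ (-β - 2) ≤ τ ^ (-β - 2) := by
      apply Real.rpow_le_rpow_of_nonpos hτ0 _ (by linarith)
      rw [le_div_iff₀ hm0]; exact hkt
    have h3 := aux_low β _ hβ ht
    have h5 := mul_le_mul_of_nonneg_left h3 (by positivity : 0 ≤ lam * m / β)
    have h6 : lam * E / m * ((k : ℝ) / m) ^ (-β - 2) ≤ lam * E / m * τ ^ (-β - 2) :=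
      mul_le_mul_of_nonneg_left h4 (by positivity)
    have e1 : lam * m / β * (1 - β * ((k : ℝ) / m - 1) +
        β * (((k : ℝ) / m - 1) ^ 2 / ((k : ℝ) / m)))
        = lam * m / β - lam * ((k : ℝ) - m) + lam * (d ^ 2 / k) := by
      rw [ht1, hdd, sq_abs]; field_simp
    rw [e1] at h5
    have h1' := (abs_le.mp h1).1
    have h2' := (abs_le.mp h2).2
    have hkd : (k : ℝ) ≤ m + d := by have := le_abs_self ((k : ℝ) - m); linarith
    have h7 : d ^ 2 / (m + d) ≤ d ^ 2 / k := by gcongr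
    have h8 : (lam - s) * ((k : ℝ) - m) ≤ lam * B / m * d := by
      calc (lam - s) * ((k : ℝ) - m) ≤ |(lam - s) * ((k : ℝ) - m)| := le_abs_self _
        _ = |lam - s| * d := abs_mul _ _
        _ ≤ _ := by
          gcongr
          rw [abs_le]; constructor <;> linarith
    have h9 : lam * E / m * (τ ^ (-β - 2) + 1) ≤ lam * (E * (τ ^ (-β - 2) + 1)) / m * d := by
      have : lam * E / m * (τ ^ (-β - 2) + 1) = lam * (E * (τ ^ (-β - 2) + 1)) / m := by ring
      rw [this]
      apply le_mul_of_one_le_right (by positivity) (by linarith)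
    set M := min (d / m) 1 with hM
    have hM1 : M ≤ d / m := min_le_left _ _
    have hM2 : M ≤ 1 := min_le_right _ _
    have hM0 : 0 ≤ M := le_min (by positivity) zero_le_one
    have g1 : M / 2 ≤ d / (m + d) := by
      rw [le_div_iff₀ (by positivity)]
      have w1 : M * m ≤ d := by rwa [le_div_iff₀ hm0] at hM1
      have w2 : M * d ≤ d := mul_le_of_le_one_left hd0.le hM2
      linarith
    have g2 : B2 / m ≤ M / 4 := by
      have : 4 * (B2 / m) ≤ M := by
        apply le_min
        · rw [← mul_div_assoc]; gcongr; linarith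
        · rw [← mul_div_assoc, div_le_one hm0]; linarith
      linarith
    have g3 : lam * (d * (M / 4)) ≤ lam * (d * (d / (m + d) - B2 / m)) := by
      gcongr; linarith
    have g4 : lam * (d * (d / (m + d) - B2 / m)) = lam * (d ^ 2 / (m + d)) - lam * B / m * d
        - lam * (E * (τ ^ (-β - 2) + 1)) / m * d := by
      rw [hB2]; field_simp; ring
    have g5 : lam * (d ^ 2 / (m + d)) ≤ lam * (d ^ 2 / k) := by gcongr
    have g6 : s / 8 * M * d ≤ lam * (d * (M / 4)) := by
      have w := mul_le_mul_of_nonneg_right hls (mul_nonneg hM0 hd0.le)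
      linarith
    rw [g4] at g3
    linarith
  · push Not at hkt
    have hkm : (k : ℝ) < m := by nlinarith
    have hdm : d ≤ m := by rw [hdd, abs_le]; constructor <;> linarith
    set q := ⌈τ * m⌉₊ with hq
    have q1 : τ * m ≤ q := Nat.le_ceil _
    have q2 : (q : ℝ) < τ * m + 1 := Nat.ceil_lt_add_one (by positivity)
    have hτm : 1 ≤ τ * m := by
      have : 1 / τ ≤ m := by linarith
      rw [div_le_iff₀ hτ0] at this; linarith
    have hq0 : (0 : ℝ) < q := by linarith
    have hkq : k ≤ q := by
      have : (k : ℝ) ≤ q := by linarith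
      exact_mod_cast this
    have hGq := hG hkq
    have hFq := (abs_le.mp (hF q (by omega))).1
    have h2' := (abs_le.mp h2).2
    set t := (q : ℝ) / m with ht
    have ht0 : 0 < t := by positivity
    have ht2 : t ≤ 2 * τ := by rw [ht, div_le_iff₀ hm0]; linarith
    have htτ : τ ≤ t := by rw [ht, le_div_iff₀ hm0]; linarith
    have e1 : t ^ (-β - 2) = t ^ (-β) / t ^ 2 := by
      rw [Real.rpow_sub ht0]; norm_num
    have hb : 1 / (2 * τ) ≤ t ^ (-β) := by
      calc 1 / (2 * τ) ≤ 1 / t := by gcongr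
        _ = t ^ (-1 : ℝ) := by rw [Real.rpow_neg_one, one_div]
        _ ≤ t ^ (-β) := Real.rpow_le_rpow_of_exponent_ge ht0 (by linarith) (by linarith)
    have hmm : 2 * E * β ≤ m ^ 2 * t ^ 2 := by
      have a1 : 2 * E * β / τ ^ 2 ≤ m := by linarith
      rw [div_le_iff₀ (by positivity)] at a1
      have a2 : τ ^ 2 ≤ t ^ 2 := by gcongr
      have a3 : (m : ℝ) ≤ m ^ 2 := by nlinarith
      calc 2 * E * β ≤ m * τ ^ 2 := a1
        _ ≤ m ^ 2 * t ^ 2 := by gcongr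
    have e2 : lam * E / m * t ^ (-β - 2) ≤ lam * m / β * t ^ (-β) / 2 := by
      rw [e1]
      have : lam * E / m * (t ^ (-β) / t ^ 2) = lam * t ^ (-β) * (E / (m * t ^ 2)) := by
        field_simp
      rw [this]
      have h' : lam * m / β * t ^ (-β) / 2 = lam * t ^ (-β) * (m / (2 * β)) := by field_simp
      rw [h']
      gcongr lam * t ^ (-β) * ?_
      rw [div_le_div_iff₀ (by positivity) (by positivity)]
      nlinarith
    have e3 : lam * m / β * (1 / (2 * τ)) ≤ lam * m / β * t ^ (-β) := by gcongr
    have e4 : lam * m / β * (1 / (2 * τ)) = 2 * (lam * m * (3 + 1 / β + E)) := by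
      rw [hτ]; field_simp; ring
    have e5 : lam * E / m ≤ lam * m * E := by
      rw [div_le_iff₀ hm0]
      have : (1 : ℝ) ≤ m * m := by nlinarith
      nlinarith [mul_pos hlam hE]
    have e6 : lam * m / β = lam * m * (1 / β) := by ring
    have e7 : s * m ≤ 2 * lam * m := mul_le_mul_of_nonneg_right (by linarith) hm0.le
    have e8 : 0 < s * k := by positivity
    have hM2 : min (d / m) 1 ≤ 1 := min_le_right _ _
    have hM0 : 0 ≤ min (d / m) 1 := le_min (by positivity) zero_le_one
    have e9 : s / 8 * min (d / m) 1 * d ≤ s / 8 * 1 * m := by gcongr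
    have e10 : 0 < lam * m := by positivity
    linarith

lemma aux_F (N C4 M1 ξ1 β : ℝ) (hN : 0 < N) (hC4 : 0 < C4) (hM1 : 0 < M1)
    (hξ1 : 2 ≤ ξ1) (hβ : 1 < β) (c : ℕ → ℝ)
    (hdecay : ∀ k : ℕ, 1 ≤ k →
      (C4 - M1 * (k : ℝ) ^ (-ξ1)) * (k : ℝ) ^ (-β) ≤ c k ∧
      c k ≤ (C4 + M1 * (k : ℝ) ^ (-ξ1)) * (k : ℝ) ^ (-β))
    (m : ℕ) (hm : 1 ≤ m) (k : ℕ) (hk : 1 ≤ k) :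
    |N * c k - (N * C4 * β * (m : ℝ) ^ (-β - 1)) * m / β * ((k : ℝ) / m) ^ (-β)|
      ≤ (N * C4 * β * (m : ℝ) ^ (-β - 1)) * (M1 / (C4 * β)) / m * ((k : ℝ) / m) ^ (-β - 2) := by
  have hm0 : (0 : ℝ) < m := by exact_mod_cast hm
  have hk0 : (0 : ℝ) < k := by exact_mod_cast hk
  have hk1 : (1 : ℝ) ≤ k := by exact_mod_cast hk
  have hβ0 : 0 < β := by linarith
  have hp : 0 < (m : ℝ) ^ (-β) := by positivity
  have hq : 0 < (k : ℝ) ^ (-β) := by positivity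
  have e1 : (N * C4 * β * (m : ℝ) ^ (-β - 1)) * m / β * ((k : ℝ) / m) ^ (-β)
      = N * (C4 * (k : ℝ) ^ (-β)) := by
    rw [Real.div_rpow hk0.le hm0.le, Real.rpow_sub hm0, Real.rpow_one]
    field_simp
  have e2 : (N * C4 * β * (m : ℝ) ^ (-β - 1)) * (M1 / (C4 * β)) / m * ((k : ℝ) / m) ^ (-β - 2)
      = N * (M1 * ((k : ℝ) ^ (-2 : ℝ) * (k : ℝ) ^ (-β))) := by
    have e3 : (k : ℝ) ^ (-2 : ℝ) * (k : ℝ) ^ (-β) = (k : ℝ) ^ (-β) / (k : ℝ) ^ 2 := by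
      rw [Real.rpow_neg hk0.le]; norm_num; field_simp
    rw [e3, Real.div_rpow hk0.le hm0.le, Real.rpow_sub hm0, Real.rpow_sub hm0,
      Real.rpow_sub hk0, Real.rpow_one]
    norm_num
    field_simp
  rw [e1, e2, ← mul_sub, abs_mul, abs_of_pos hN]
  apply mul_le_mul_of_nonneg_left _ hN.le
  obtain ⟨h1, h2⟩ := hdecay k hk
  have h3 : (k : ℝ) ^ (-ξ1) ≤ (k : ℝ) ^ (-2 : ℝ) :=
    Real.rpow_le_rpow_of_exponent_le hk1 (by linarith)
  have h4 : M1 * ((k : ℝ) ^ (-ξ1) * (k : ℝ) ^ (-β)) ≤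
      M1 * ((k : ℝ) ^ (-2 : ℝ) * (k : ℝ) ^ (-β)) := by gcongr
  rw [abs_le]
  constructor <;> linarith

/-- algebraic-decay case — the basin inequality (3.7) for
`L_n(k) = (k/N)σ² + c_k` with algebraically decaying `c_k`, and the consequence that
condition (K.6) holds with any `θ ∈ (1 − min{ξ,1}, 1)` for any `ξ > 0`. -/
theorem stmt_17
    (σ2 C4 M1 ξ1 δ1 β : ℝ) (hσ2 : 0 < σ2) (hC4 : 0 < C4) (hM1 : 0 < M1)
    (hξ1 : 2 ≤ ξ1) (hδ1 : 0 < δ1) (hβ : 1 + δ1 < β)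
    (c : ℕ → ℝ) (hmono : Antitone c) (hnonneg : ∀ k, 0 ≤ c k)
    (hdecay : ∀ k : ℕ, 1 ≤ k →
      (C4 - M1 * (k : ℝ) ^ (-ξ1)) * (k : ℝ) ^ (-β) ≤ c k ∧
      c k ≤ (C4 + M1 * (k : ℝ) ^ (-ξ1)) * (k : ℝ) ^ (-β))
    (K : ℕ → ℕ) (Cl Cu : ℝ) (hCl : 0 < Cl) (hCu : 0 < Cu)
    (hK4 : ∀ n : ℕ, 1 ≤ n →
      Cl ≤ (K n : ℝ) ^ ((2 : ℝ) + δ1) / (n : ℝ) ∧ (K n : ℝ) ^ ((2 : ℝ) + δ1) / (n : ℝ) ≤ Cu)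
    (L : ℕ → ℕ → ℝ)
    (hL : ∀ n k, L n k = (k : ℝ) / ((n : ℝ) - (K n : ℝ)) * σ2 + c k)
    (kstar : ℕ → ℕ)
    (hkstar : ∀ n, kstar n ∈ Finset.Icc 1 (K n) ∧
      ∀ k ∈ Finset.Icc 1 (K n), L n (kstar n) ≤ L n k) :
    (∃ C6 C7 : ℝ, 0 < C6 ∧ 0 < C7 ∧ ∃ n0 : ℕ, ∀ n ≥ n0,
      ∀ k ∈ Finset.Icc 1 (K n), C6 < |(k : ℝ) - (kstar n : ℝ)| →
        C7 * min (|(k : ℝ) - (kstar n : ℝ)| / (kstar n : ℝ)) 1 ≤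
          ((n : ℝ) - (K n : ℝ)) * (L n k - L n (kstar n)) / |(k : ℝ) - (kstar n : ℝ)|) ∧
    (∀ ξ : ℝ, 0 < ξ → ∀ θ : ℝ, 1 - min ξ 1 < θ → θ < 1 →
      ∃ Cbar : ℝ, 0 < Cbar ∧ ∃ n0 : ℕ, ∀ n ≥ n0,
        ∀ k ∈ Finset.Icc 1 (K n), (kstar n : ℝ) ^ θ ≤ |(k : ℝ) - (kstar n : ℝ)| →
          Cbar ≤ (kstar n : ℝ) ^ ξ *
            (((n : ℝ) - (K n : ℝ)) * (L n k - L n (kstar n)) / |(k : ℝ) - (kstar n : ℝ)|)) := by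
  classical
  have hβ1 : 1 < β := by linarith
  have hβ0 : 0 < β := by linarith
  have hE : 0 < M1 / (C4 * β) := by positivity
  have hK1 : ∀ n, 1 ≤ K n := fun n => by
    have := Finset.mem_Icc.mp (hkstar n).1; omega
  -- N is at least n / 2
  have hNev : ∀ᶠ n : ℕ in atTop, (n : ℝ) / 2 ≤ (n : ℝ) - K n := by
    filter_upwards [eventually_ge_atTop 1,
      tendsto_natCast_atTop_atTop.eventually_ge_atTop (4 * Cu + 1)] with n hn hn2
    have hn0 : (0 : ℝ) < n := by exact_mod_cast hn
    have h := (hK4 n hn).2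
    rw [div_le_iff₀ hn0] at h
    have hKn : (1 : ℝ) ≤ K n := by exact_mod_cast hK1 n
    have h2 : (K n : ℝ) ^ (2 : ℝ) ≤ (K n : ℝ) ^ (2 + δ1) :=
      Real.rpow_le_rpow_of_exponent_le hKn (by linarith)
    rw [Real.rpow_two] at h2
    by_contra hc
    push Not at hc
    nlinarith
  have hNtop : Tendsto (fun n : ℕ => (n : ℝ) - K n) atTop atTop := by
    apply tendsto_atTop_mono' _ hNev
    exact tendsto_natCast_atTop_atTop.atTop_div_const (by norm_num)
  have hKtop : Tendsto (fun n : ℕ => (K n : ℝ)) atTop atTop := by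
    rw [tendsto_atTop]
    intro A
    filter_upwards [eventually_ge_atTop 1,
      tendsto_natCast_atTop_atTop.eventually_gt_atTop (|A| ^ (2 + δ1) / Cl)] with n hn hn2
    have hn0 : (0 : ℝ) < n := by exact_mod_cast hn
    have h := (hK4 n hn).1
    rw [le_div_iff₀ hn0] at h
    rw [div_lt_iff₀ hCl] at hn2
    by_contra hc
    push Not at hc
    have : (K n : ℝ) ^ (2 + δ1) ≤ |A| ^ (2 + δ1) :=
      Real.rpow_le_rpow (by positivity) (hc.le.trans (le_abs_self A)) (by linarith)
    linarith
  -- the minimizer tends to infinity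
  have hmtop : Tendsto (fun n : ℕ => (kstar n : ℝ)) atTop atTop := by
    rw [tendsto_atTop]
    intro A
    obtain ⟨A', hA'⟩ := exists_nat_gt (|A| + M1 / C4 + 1)
    have hMC : 0 < M1 / C4 := by positivity
    have hA1 : (1 : ℝ) < A' := by have := abs_nonneg A; linarith
    have hA1' : 1 ≤ A' := by exact_mod_cast hA1.le
    have hA0 : (0 : ℝ) < A' := by linarith
    have hcA : 0 < c A' := by
      have h := (hdecay A' hA1').1
      have h3 : (A' : ℝ) ^ (-ξ1) ≤ (A' : ℝ) ^ (-1 : ℝ) :=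
        Real.rpow_le_rpow_of_exponent_le hA1.le (by linarith)
      rw [Real.rpow_neg_one] at h3
      have h4 : M1 * (A' : ℝ) ^ (-ξ1) ≤ M1 * (A' : ℝ)⁻¹ := by gcongr
      have h5 : M1 * (A' : ℝ)⁻¹ < C4 := by
        rw [← div_eq_mul_inv, div_lt_iff₀ hA0]
        have : M1 / C4 < A' := by have := abs_nonneg A; linarith
        rw [div_lt_iff₀ hC4] at this; linarith
      have h6 : 0 < (C4 - M1 * (A' : ℝ) ^ (-ξ1)) * (A' : ℝ) ^ (-β) :=
        mul_pos (by linarith) (by positivity)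
      linarith
    obtain ⟨b, hb⟩ := exists_nat_gt ((C4 + M1) / (c A' / 2) + 1)
    have hbp : 0 < (C4 + M1) / (c A' / 2) := by positivity
    have hb1 : (1 : ℝ) < b := by linarith
    have hb1' : 1 ≤ b := by exact_mod_cast hb1.le
    have hb0 : (0 : ℝ) < b := by linarith
    have hcb : c b < c A' / 2 := by
      have h := (hdecay b hb1').2
      have h3 : (b : ℝ) ^ (-ξ1) ≤ 1 :=
        Real.rpow_le_one_of_one_le_of_nonpos hb1.le (by linarith)
      have h4 : (b : ℝ) ^ (-β) ≤ (b : ℝ) ^ (-1 : ℝ) :=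
        Real.rpow_le_rpow_of_exponent_le hb1.le (by linarith)
      rw [Real.rpow_neg_one] at h4
      have h5 : (C4 + M1 * (b : ℝ) ^ (-ξ1)) * (b : ℝ) ^ (-β) ≤ (C4 + M1 * 1) * (b : ℝ)⁻¹ := by
        gcongr
      have h6 : (C4 + M1 * 1) * (b : ℝ)⁻¹ < c A' / 2 := by
        rw [← div_eq_mul_inv, div_lt_iff₀ hb0, mul_one]
        have : (C4 + M1) / (c A' / 2) < b := by linarith
        rw [div_lt_iff₀ (by positivity)] at this; linarith
      linarith
    filter_upwards [hKtop.eventually_ge_atTop (b : ℝ), hNtop.eventually_gt_atTop 0,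
      hNtop.eventually_gt_atTop (b * σ2 / (c A' / 2))] with n h1 h2 h3
    by_contra hc
    push Not at hc
    have hmA : kstar n ≤ A' := by
      have : (kstar n : ℝ) ≤ A' := by have := le_abs_self A; linarith
      exact_mod_cast this
    have hopt := (hkstar n).2 b (Finset.mem_Icc.mpr ⟨hb1', by exact_mod_cast h1⟩)
    rw [hL, hL] at hopt
    have g1 := hmono hmA
    have g2 : 0 ≤ (kstar n : ℝ) / ((n : ℝ) - K n) * σ2 := by positivity
    have g3 : (b : ℝ) / ((n : ℝ) - K n) * σ2 < c A' / 2 := by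
      rw [div_lt_iff₀ (by positivity)] at h3
      rw [div_mul_eq_mul_div, div_lt_iff₀ h2]; linarith
    linarith
  set lam : ℕ → ℝ := fun n => ((n : ℝ) - K n) * C4 * β * (kstar n : ℝ) ^ (-β - 1) with hlam
  -- facts in scaled form
  have hm1 : ∀ n, 1 ≤ kstar n := fun n => (Finset.mem_Icc.mp (hkstar n).1).1
  have hscale : ∀ n : ℕ, 0 < (n : ℝ) - K n → ∀ k : ℕ,
      ((n : ℝ) - K n) * L n k = ((n : ℝ) - K n) * c k + σ2 * k := by
    intro n hn k
    rw [hL]; field_simp; ring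
  have hopt : ∀ n : ℕ, 0 < (n : ℝ) - K n → ∀ k : ℕ, 1 ≤ k → k ≤ K n →
      ((n : ℝ) - K n) * c (kstar n) + σ2 * (kstar n : ℕ) ≤ ((n : ℝ) - K n) * c k + σ2 * k := by
    intro n hn k h1 h2
    rw [← hscale n hn, ← hscale n hn]
    exact mul_le_mul_of_nonneg_left ((hkstar n).2 k (Finset.mem_Icc.mpr ⟨h1, h2⟩)) hn.le
  have hlampos : ∀ n : ℕ, 0 < (n : ℝ) - K n → 0 < lam n := by
    intro n hn
    have : (0 : ℝ) < kstar n := by exact_mod_cast hm1 n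
    simp only [hlam]; positivity
  -- the minimizer is interior
  have hint : ∀ᶠ n : ℕ in atTop, kstar n + 1 ≤ K n := by
    set B : ℝ := 2 * β + M1 / (C4 * β) * ((1 / 2 : ℝ) ^ (-β - 2) + 1) with hB
    have hBpos : 0 < B := by positivity
    have hz : Tendsto (fun n : ℕ => (K n : ℝ) ^ (-(β - 1 - δ1))) atTop (nhds 0) :=
      (tendsto_rpow_neg_atTop (by linarith)).comp hKtop
    have hpos : 0 < σ2 / (2 * (C4 * β / Cl)) := by positivity
    filter_upwards [hNtop.eventually_gt_atTop 0, hz.eventually_lt_const hpos,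
      hmtop.eventually_ge_atTop (2 * β + B), eventually_ge_atTop 1] with n hn h1 h2 hn1
    by_contra hc
    have hle := (Finset.mem_Icc.mp (hkstar n).1).2
    have hKm : kstar n = K n := by omega
    have hm2 : (2 : ℝ) < kstar n := by linarith
    have hm2' : 2 < kstar n := by exact_mod_cast hm2
    have hm0 : (0 : ℝ) < kstar n := by linarith
    have hn0 : (0 : ℝ) < n := by exact_mod_cast hn1
    have n2 := aux_near σ2 β _ hβ1 hE (kstar n) (kstar n - 1) (lam n)
      (fun k => ((n : ℝ) - K n) * c k) (hlampos n hn) (by linarith) (by omega)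
      (by rw [Nat.cast_sub (by omega)]; push_cast; norm_num)
      (fun k hk => aux_F _ C4 M1 ξ1 β hn hC4 hM1 hξ1 hβ1 c hdecay _ (hm1 n) k hk)
      (hopt n hn _ (by omega) (by omega))
    rw [Nat.cast_sub (by omega), ← hB] at n2
    push_cast at n2
    have hl := hlampos n hn
    have hBm : lam n * B / kstar n ≤ lam n := by
      rw [div_le_iff₀ hm0]
      exact mul_le_mul_of_nonneg_left (by linarith) hl.le
    have hsl : σ2 ≤ 2 * lam n := by linarith
    have hk4 := (hK4 n hn1).1
    rw [le_div_iff₀ hn0] at hk4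
    have hK0 : (0 : ℝ) < K n := by rw [← hKm]; exact hm0
    have hNle : (n : ℝ) - K n ≤ (K n : ℝ) ^ (2 + δ1) / Cl := by
      rw [le_div_iff₀ hCl]; nlinarith
    have hlle : lam n ≤ (C4 * β / Cl) * (K n : ℝ) ^ (-(β - 1 - δ1)) := by
      have e : (K n : ℝ) ^ (-(β - 1 - δ1)) = (K n : ℝ) ^ (2 + δ1) * (K n : ℝ) ^ (-β - 1) := by
        rw [← Real.rpow_add hK0]; congr 1; ring
      simp only [hlam]
      rw [hKm, e]
      calc ((n : ℝ) - K n) * C4 * β * (K n : ℝ) ^ (-β - 1)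
          ≤ ((K n : ℝ) ^ (2 + δ1) / Cl) * C4 * β * (K n : ℝ) ^ (-β - 1) := by gcongr
        _ = _ := by ring
    rw [lt_div_iff₀ (by positivity)] at h1
    linarith
  obtain ⟨m0, C6, C7, hC6, hC7, hcore⟩ := aux_core σ2 β _ hσ2 hβ1 hE
  have hpart1 : ∀ᶠ n : ℕ in atTop, ∀ k ∈ Finset.Icc 1 (K n), C6 < |(k : ℝ) - (kstar n : ℝ)| →
        C7 * min (|(k : ℝ) - (kstar n : ℝ)| / (kstar n : ℝ)) 1 ≤
          ((n : ℝ) - (K n : ℝ)) * (L n k - L n (kstar n)) / |(k : ℝ) - (kstar n : ℝ)| := by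
    filter_upwards [hNtop.eventually_gt_atTop 0, hmtop.eventually_ge_atTop m0, hint]
      with n hn hm hi k hk hd
    obtain ⟨hk1, hk2⟩ := Finset.mem_Icc.mp hk
    have h := hcore (kstar n) (K n) (lam n) (fun k => ((n : ℝ) - K n) * c k) hm hi
      (hlampos n hn) (fun a b hab => mul_le_mul_of_nonneg_left (hmono hab) hn.le)
      (fun k hk => aux_F _ C4 M1 ξ1 β hn hC4 hM1 hξ1 hβ1 c hdecay _ (hm1 n) k hk)
      (hopt n hn) k hk1 hk2 hd
    rw [le_div_iff₀ (by linarith), mul_sub, hscale n hn, hscale n hn]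
    exact h
  refine ⟨?_, ?_⟩
  · obtain ⟨n0, hn0⟩ := eventually_atTop.mp hpart1
    exact ⟨C6, C7, hC6, hC7, n0, hn0⟩
  · intro ξ hξ θ hθ hθ1
    refine ⟨C7, hC7, ?_⟩
    apply eventually_atTop.mp
    have hmin1 : min ξ 1 ≤ ξ := min_le_left _ _
    have hmin2 : min ξ 1 ≤ 1 := min_le_right _ _
    have hθtop := (tendsto_rpow_atTop (by linarith : 0 < θ)).comp hmtop
    filter_upwards [hpart1, hθtop.eventually_gt_atTop C6] with n h1 h2 k hk hd
    simp only [Function.comp] at h2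
    have h := h1 k hk (by linarith)
    have hmge : (1 : ℝ) ≤ kstar n := by exact_mod_cast hm1 n
    have hm0 : (0 : ℝ) < kstar n := by linarith
    have g1 : (kstar n : ℝ) ^ (θ - 1) ≤ min (|(k : ℝ) - (kstar n : ℝ)| / (kstar n : ℝ)) 1 := by
      apply le_min
      · rw [Real.rpow_sub_one hm0.ne']
        gcongr
      · exact Real.rpow_le_one_of_one_le_of_nonpos hmge (by linarith)
    have g2 : 1 ≤ (kstar n : ℝ) ^ ξ * (kstar n : ℝ) ^ (θ - 1) := by
      rw [← Real.rpow_add hm0]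
      exact Real.one_le_rpow hmge (by linarith)
    calc C7 = C7 * 1 := (mul_one _).symm
      _ ≤ C7 * ((kstar n : ℝ) ^ ξ * (kstar n : ℝ) ^ (θ - 1)) := by gcongr
      _ = (kstar n : ℝ) ^ ξ * (C7 * (kstar n : ℝ) ^ (θ - 1)) := by ring
      _ ≤ (kstar n : ℝ) ^ ξ * (C7 * min (|(k : ℝ) - (kstar n : ℝ)| / (kstar n : ℝ)) 1) := by
        gcongr
      _ ≤ _ := by gcongr
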